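/- Let f : ℝ^d → ℝ be a CPA function having at most k affine components (i.e., there exist at most k affine functions g_1, …, g_k : ℝ^d → ℝ with: for every x there is i with f(x) = g_i(x)). Let B ⊆ ℝ^d be an open ball and z_min < z_max real numbers with f(B) ⊆ (z_min, z_max), and suppose there are p pairwise distinct maximal pieces of f each intersecting B. Define the clamped function f̄(x) := min(z_max, max(z_min, f(x))). Then f̄ is CPA, satisfies z_min ≤ f̄(x) ≤ z_max for all x, has at most k + 2 affine components, and has at least p pairwise distinct maximal pieces. -/

import Mathlib

/-- An affine function `ℝ^d → ℝ`, i.e. a map of the form `x ↦ ⟨a, x⟩ + b`. -/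
def IsAffineFn {d : ℕ} (g : (Fin d → ℝ) → ℝ) : Prop :=
  ∃ (a : Fin d → ℝ) (b : ℝ), ∀ x, g x = (∑ i, a i * x i) + b

/-- `f` agrees with some affine map on the set `P`. -/
def AffineOnSet {d : ℕ} (f : (Fin d → ℝ) → ℝ) (P : Set (Fin d → ℝ)) : Prop :=
  ∃ g : (Fin d → ℝ) → ℝ, IsAffineFn g ∧ ∀ x ∈ P, f x = g x

/-- `Ps` is an admissible (finite) set of pieces for `f`: all pieces are open,
connected, `f` is affine on each of them, and their closures cover `ℝ^d`. -/
def IsPieceSet {d : ℕ} (f : (Fin d → ℝ) → ℝ) (Ps : Finset (Set (Fin d → ℝ))) : Prop :=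
  (∀ P ∈ Ps, IsOpen P ∧ IsConnected P ∧ AffineOnSet f P) ∧
    (⋃ P ∈ Ps, closure P) = Set.univ

/-- A continuous piecewise affine (CPA) function. -/
def IsCPA {d : ℕ} (f : (Fin d → ℝ) → ℝ) : Prop :=
  Continuous f ∧ ∃ Ps : Finset (Set (Fin d → ℝ)), IsPieceSet f Ps

/-- `P` is a maximal piece of `f`: open, connected, `f` affine on `P`, and it cannot
be enlarged by a nonempty set `U ⊆ ℝ^d \ P` keeping openness, connectedness and affineness. -/
def IsMaximalPiece {d : ℕ} (f : (Fin d → ℝ) → ℝ) (P : Set (Fin d → ℝ)) : Prop :=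
  IsOpen P ∧ IsConnected P ∧ AffineOnSet f P ∧
    ¬ ∃ U : Set (Fin d → ℝ), U.Nonempty ∧ U ⊆ Pᶜ ∧ IsOpen (P ∪ U) ∧
      IsConnected (P ∪ U) ∧ AffineOnSet f (P ∪ U)

open Set Filter Topology

namespace IsAffineFn

variable {d : ℕ} {g g' : (Fin d → ℝ) → ℝ}

theorem const (c : ℝ) : IsAffineFn (fun _ : Fin d → ℝ => c) :=
  ⟨0, c, fun x => by simp⟩

theorem sub (hg : IsAffineFn g) (hg' : IsAffineFn g') : IsAffineFn (fun x => g x - g' x) := by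
  obtain ⟨a, b, h⟩ := hg
  obtain ⟨a', b', h'⟩ := hg'
  refine ⟨a - a', b - b', fun x => ?_⟩
  simp only [h, h', Pi.sub_apply, sub_mul, Finset.sum_sub_distrib]
  ring

theorem neg (hg : IsAffineFn g) : IsAffineFn (fun x => -g x) := by
  simpa using (const 0).sub hg

theorem continuous (hg : IsAffineFn g) : Continuous g := by
  obtain ⟨a, b, h⟩ := hg
  rw [funext h]
  fun_prop

theorem map_combo (hg : IsAffineFn g) (x y : Fin d → ℝ) {s t : ℝ} (hst : s + t = 1) :
    g (s • x + t • y) = s * g x + t * g y := by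
  obtain ⟨a, b, h⟩ := hg
  have hb : b = s * b + t * b := by rw [← add_mul, hst, one_mul]
  simp only [h, Pi.add_apply, Pi.smul_apply, smul_eq_mul, mul_add, Finset.sum_add_distrib,
    Finset.mul_sum]
  have h₁ : ∑ i, a i * (s * x i) = ∑ i, s * (a i * x i) :=
    Finset.sum_congr rfl fun i _ => by ring
  have h₂ : ∑ i, a i * (t * y i) = ∑ i, t * (a i * y i) :=
    Finset.sum_congr rfl fun i _ => by ring
  rw [h₁, h₂]
  linarith

theorem convexOn (hg : IsAffineFn g) : ConvexOn ℝ univ g :=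
  ⟨convex_univ, fun x _ y _ _ _ _ _ hst => (hg.map_combo x y hst).le⟩

theorem eq_of_isLocalMin (hg : IsAffineFn g) {x : Fin d → ℝ} (hx : IsLocalMin g x)
    (y : Fin d → ℝ) : g y = g x := by
  have hmin := IsMinOn.of_isLocalMin_of_convex_univ hx hg.convexOn
  have h := hmin ((2 : ℝ) • x + (-1 : ℝ) • y)
  rw [hg.map_combo x y (by norm_num)] at h
  linarith [hmin y]

theorem eq_of_eventuallyEq (hg : IsAffineFn g) (hg' : IsAffineFn g') {x : Fin d → ℝ}
    (h : g =ᶠ[𝓝 x] g') : g = g' := by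
  have hmin : IsLocalMin (fun y => g y - g' y) x := by
    filter_upwards [h] with y hy
    rw [hy, h.eq_of_nhds, sub_self, sub_self]
  funext y
  have hy := (hg.sub hg').eq_of_isLocalMin hmin y
  have hx := h.eq_of_nhds
  linarith

theorem eq_of_eqOn (hg : IsAffineFn g) (hg' : IsAffineFn g') {S : Set (Fin d → ℝ)}
    (hS : IsOpen S) (hne : S.Nonempty) (h : EqOn g g' S) : g = g' := by
  obtain ⟨x, hx⟩ := hne
  exact hg.eq_of_eventuallyEq hg' (h.eventuallyEq_of_mem (hS.mem_nhds hx))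

/-- An affine function bounded below by `c` on an open set and exceeding `c` somewhere never
attains `c` on that set. -/
theorem lt_of_le_on_isOpen (hg : IsAffineFn g) {S : Set (Fin d → ℝ)} (hS : IsOpen S) {c : ℝ}
    (h : ∀ y ∈ S, c ≤ g y) {x y : Fin d → ℝ} (hx : c < g x) (hy : y ∈ S) : c < g y := by
  refine (h y hy).lt_of_ne fun heq => ?_
  have hmin : IsLocalMin g y := by
    filter_upwards [hS.mem_nhds hy] with z hz
    exact heq ▸ h z hz
  rw [hg.eq_of_isLocalMin hmin x, ← heq] at hx
  exact lt_irrefl _ hx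

theorem dense_ne (hg : IsAffineFn g) (hg' : IsAffineFn g') (hne : g ≠ g') :
    Dense {x | g x ≠ g' x} := by
  have : {x | g x ≠ g' x} = {x | g x = g' x}ᶜ := rfl
  rw [this, ← interior_eq_empty_iff_dense_compl, ← not_nonempty_iff_eq_empty]
  exact fun h => hne (hg.eq_of_eqOn hg' isOpen_interior h fun x hx =>
    interior_subset (s := {x | g x = g' x}) hx)

end IsAffineFn

section Cells

variable {d : ℕ} {ι : Type*}

/-- The cell of the arrangement of the hyperplanes `{g i = g j}` determined by the signs `s`. -/
def arrangementCell (g : ι → (Fin d → ℝ) → ℝ) (s : ι × ι → Bool) : Set (Fin d → ℝ) :=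
  ⋂ q : ι × ι, {x | g q.1 ≠ g q.2 → if s q then g q.1 x < g q.2 x else g q.2 x < g q.1 x}

variable {g : ι → (Fin d → ℝ) → ℝ}

theorem isOpen_arrangementCell [Finite ι] (hg : ∀ i, IsAffineFn (g i)) (s : ι × ι → Bool) :
    IsOpen (arrangementCell g s) := by
  refine isOpen_iInter_of_finite fun q => ?_
  by_cases h : g q.1 = g q.2
  · simp [h]
  · cases hs : s q
    · simpa [h] using isOpen_lt (hg q.2).continuous (hg q.1).continuous
    · simpa [h] using isOpen_lt (hg q.1).continuous (hg q.2).continuous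

theorem convex_arrangementCell (hg : ∀ i, IsAffineFn (g i)) (s : ι × ι → Bool) :
    Convex ℝ (arrangementCell g s) := by
  have key : ∀ i j, Convex ℝ {x | g i x < g j x} := fun i j => by
    simpa [sub_neg] using ((hg i).sub (hg j)).convexOn.convex_lt 0
  refine convex_iInter fun q => ?_
  by_cases h : g q.1 = g q.2
  · simp [h, convex_univ]
  · cases hs : s q
    · simpa [h] using key q.2 q.1
    · simpa [h] using key q.1 q.2

theorem ne_of_mem_arrangementCell {s : ι × ι → Bool} {x : Fin d → ℝ}
    (hx : x ∈ arrangementCell g s) {i j : ι} (h : g i ≠ g j) : g i x ≠ g j x := by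
  have := mem_iInter.1 hx (i, j) h
  dsimp only at this
  split_ifs at this
  exacts [this.ne, this.ne']

theorem dense_iUnion_arrangementCell [Finite ι] (hg : ∀ i, IsAffineFn (g i)) :
    Dense (⋃ s, arrangementCell g s) := by
  classical
  have hd : Dense (⋂ q : ι × ι, {x | g q.1 ≠ g q.2 → g q.1 x ≠ g q.2 x}) := by
    have ho : ∀ q : ι × ι, IsOpen {x | g q.1 ≠ g q.2 → g q.1 x ≠ g q.2 x} := fun q => by
      by_cases h : g q.1 = g q.2
      · simp [h]
      · simpa [h] using isOpen_ne_fun (hg q.1).continuous (hg q.2).continuous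
    refine dense_iInter_of_isOpen ho fun q => ?_
    by_cases h : g q.1 = g q.2
    · simp [h]
    · simpa [h] using (hg q.1).dense_ne (hg q.2) h
  refine hd.mono fun x hx => mem_iUnion.2 ⟨fun q => decide (g q.1 x < g q.2 x), ?_⟩
  refine mem_iInter.2 fun q hq => ?_
  have hne : g q.1 x ≠ g q.2 x := mem_iInter.1 hx q hq
  by_cases hlt : g q.1 x < g q.2 x
  · simp [hlt]
  · simpa [hlt] using lt_of_le_of_ne (not_lt.1 hlt) hne.symm

theorem affineOnSet_arrangementCell [Finite ι] (hg : ∀ i, IsAffineFn (g i))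
    {f : (Fin d → ℝ) → ℝ} (hf : Continuous f) (hfg : ∀ x, ∃ i, f x = g i x)
    {s : ι × ι → Bool} (hne : (arrangementCell g s).Nonempty) :
    AffineOnSet f (arrangementCell g s) := by
  obtain ⟨x, hx⟩ := hne
  obtain ⟨i, hi⟩ := hfg x
  refine ⟨g i, hg i, fun y hy => ?_⟩
  have hclosed : ∀ j, IsClosed {y | f y = g j y} := fun j => isClosed_eq hf (hg j).continuous
  have hpre := isPreconnected_closed_iff.1 (convex_arrangementCell hg s).isPreconnected
    {y | f y = g i y} (⋃ j : {j // g j ≠ g i}, {y | f y = g j y})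
    (hclosed i) (isClosed_iUnion_of_finite fun j => hclosed j)
    (fun z _ => by
      obtain ⟨j, hj⟩ := hfg z
      by_cases h : g j = g i
      · exact Or.inl (h ▸ hj)
      · exact Or.inr (mem_iUnion.2 ⟨⟨j, h⟩, hj⟩))
    ⟨x, hx, hi⟩
  by_contra hy'
  obtain ⟨j, hj⟩ := hfg y
  have hji : g j ≠ g i := fun h => hy' (h ▸ hj)
  obtain ⟨z, hz, hzi, hzu⟩ := hpre ⟨y, hy, mem_iUnion.2 ⟨⟨j, hji⟩, hj⟩⟩
  obtain ⟨⟨l, hl⟩, hzl⟩ := mem_iUnion.1 hzu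
  exact ne_of_mem_arrangementCell hz hl (hzl.symm.trans hzi)

/-- A continuous selection of finitely many affine functions is CPA. -/
theorem isCPA_of_finite_components [Fintype ι] (hg : ∀ i, IsAffineFn (g i))
    {f : (Fin d → ℝ) → ℝ} (hf : Continuous f) (hfg : ∀ x, ∃ i, f x = g i x) : IsCPA f := by
  classical
  refine ⟨hf, (Finset.univ.image (arrangementCell g)).filter Set.Nonempty, ?_, ?_⟩
  · intro P hP
    obtain ⟨hP, hne⟩ := Finset.mem_filter.1 hP
    obtain ⟨s, -, rfl⟩ := Finset.mem_image.1 hP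
    exact ⟨isOpen_arrangementCell hg s, ⟨hne, (convex_arrangementCell hg s).isPreconnected⟩,
      affineOnSet_arrangementCell hg hf hfg hne⟩
  · refine eq_univ_of_forall fun x => ?_
    have hx := dense_iUnion_arrangementCell hg x
    rw [closure_iUnion_of_finite] at hx
    obtain ⟨s, hs⟩ := mem_iUnion.1 hx
    refine mem_iUnion₂.2 ⟨arrangementCell g s, ?_, hs⟩
    exact Finset.mem_filter.2 ⟨Finset.mem_image_of_mem _ (Finset.mem_univ s),
      closure_nonempty_iff.1 ⟨x, hs⟩⟩

end Cells

section MaximalPieces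

variable {d : ℕ} {f : (Fin d → ℝ) → ℝ}

/-- A maximal piece contains every affine piece that it meets. -/
theorem IsMaximalPiece.subset_of_inter_nonempty {P S : Set (Fin d → ℝ)}
    (hP : IsMaximalPiece f P) (hS : IsOpen S) (hSc : IsConnected S) (hSa : AffineOnSet f S)
    (hne : (P ∩ S).Nonempty) : S ⊆ P := by
  obtain ⟨hPo, hPc, ⟨g, hg, hfg⟩, hmax⟩ := hP
  obtain ⟨g', hg', hfg'⟩ := hSa
  have heq : g = g' := hg.eq_of_eqOn hg' (hPo.inter hS) hne
    fun x hx => (hfg x hx.1).symm.trans (hfg' x hx.2)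
  subst heq
  by_contra hsub
  refine hmax ⟨S \ P, sdiff_nonempty.2 hsub, fun x hx => hx.2, ?_, ?_, g, hg, ?_⟩
  · rw [union_sdiff_self]
    exact hPo.union hS
  · rw [union_sdiff_self]
    exact hPc.union hne hSc
  · rw [union_sdiff_self]
    exact fun x hx => hx.elim (hfg x) (hfg' x)

/-- The component around `x` of the region where `f` locally agrees with an affine `g` is a
maximal piece. -/
theorem isMaximalPiece_connectedComponentIn {g : (Fin d → ℝ) → ℝ} (hg : IsAffineFn g)
    {x : Fin d → ℝ} (hx : x ∈ interior {y | f y = g y}) :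
    IsMaximalPiece f (connectedComponentIn (interior {y | f y = g y}) x) := by
  have ho : IsOpen (connectedComponentIn (interior {y | f y = g y}) x) :=
    isOpen_interior.connectedComponentIn
  have hxQ := mem_connectedComponentIn hx
  have hfg : ∀ y ∈ connectedComponentIn (interior {y | f y = g y}) x, f y = g y :=
    fun y hy => interior_subset (s := {y | f y = g y}) (connectedComponentIn_subset _ _ hy)
  refine ⟨ho, isConnected_connectedComponentIn_iff.2 hx, ⟨g, hg, hfg⟩, ?_⟩
  rintro ⟨U, ⟨u, hu⟩, hUc, hUo, hUconn, g', hg', hfg'⟩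
  have heq : g = g' := hg.eq_of_eqOn hg' ho ⟨x, hxQ⟩
    fun y hy => (hfg y hy).symm.trans (hfg' y (Or.inl hy))
  subst heq
  exact hUc hu (hUconn.isPreconnected.subset_connectedComponentIn (Or.inl hxQ)
    (interior_maximal hfg' hUo) (Or.inr hu))

/-- Around a point of a maximal piece of `f` at which `f` is not clamped, the clamped function
has a maximal piece contained in the given one. -/
theorem IsMaximalPiece.exists_clamp_subset {P : Set (Fin d → ℝ)} (hP : IsMaximalPiece f P)
    (hf : Continuous f) {a b : ℝ} {x : Fin d → ℝ} (hx : x ∈ P) (hfx : f x ∈ Ioo a b) :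
    ∃ Q, IsMaximalPiece (fun y => min b (max a (f y))) Q ∧ x ∈ Q ∧ Q ⊆ P := by
  have hab : a < b := hfx.1.trans hfx.2
  obtain ⟨g, hg, hfg⟩ := hP.2.2.1
  have hxi : x ∈ interior {y | min b (max a (f y)) = g y} := by
    refine mem_interior.2 ⟨P ∩ f ⁻¹' Ioo a b, ?_, hP.1.inter (isOpen_Ioo.preimage hf), hx, hfx⟩
    rintro y ⟨hy, hya, hyb⟩
    rw [mem_ofPred_eq, max_eq_right hya.le, min_eq_right hyb.le, hfg y hy]
  have hQ := isMaximalPiece_connectedComponentIn (f := fun y => min b (max a (f y))) hg hxi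
  have hxQ := mem_connectedComponentIn hxi
  refine ⟨_, hQ, hxQ, hP.subset_of_inter_nonempty hQ.1 hQ.2.1 ⟨g, hg, fun y hy => ?_⟩ ⟨x, hx, hxQ⟩⟩
  have hclamp : ∀ z ∈ connectedComponentIn (interior {y | min b (max a (f y)) = g y}) x,
      min b (max a (f z)) = g z :=
    fun z hz => interior_subset (s := {y | min b (max a (f y)) = g y})
      (connectedComponentIn_subset _ _ hz)
  rw [hfg x hx] at hfx
  have hlo : a < g y := hg.lt_of_le_on_isOpen hQ.1
    (fun z hz => hclamp z hz ▸ le_min hab.le (le_max_left _ _)) hfx.1 hy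
  have hhi : -b < -g y := hg.neg.lt_of_le_on_isOpen hQ.1
    (fun z hz => neg_le_neg (hclamp z hz ▸ min_le_left _ _)) (neg_lt_neg hfx.2) hy
  have hy' := hclamp y hy
  rcases min_choice b (max a (f y)) with h | h
  · linarith
  · rcases max_choice a (f y) with h' | h' <;> linarith

end MaximalPieces

/-- Let `f` be CPA with at most `k` affine components, `B` an open
(Euclidean) ball with `f '' B ⊆ (zmin, zmax)`, and suppose `p` pairwise distinct maximal
pieces of `f` each meet `B`. Then the clamped function
`fbar x = min zmax (max zmin (f x))` is CPA, takes values in `[zmin, zmax]`, has at most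
`k + 2` affine components, and has at least `p` pairwise distinct maximal pieces. -/
theorem clamp_preserves_pieces {d : ℕ} (f : (Fin d → ℝ) → ℝ) (hf : IsCPA f)
    (k : ℕ)
    (hcomp : ∃ g : Fin k → (Fin d → ℝ) → ℝ,
      (∀ i, IsAffineFn (g i)) ∧ ∀ x, ∃ i, f x = g i x)
    (B : Set (Fin d → ℝ)) (x₀ : Fin d → ℝ) (r : ℝ) (hr : 0 < r)
    (hB : B = {x : Fin d → ℝ | ∑ i, (x i - x₀ i) ^ 2 < r ^ 2})
    (zmin zmax : ℝ) (hz : zmin < zmax) (hfB : f '' B ⊆ Set.Ioo zmin zmax)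
    (p : ℕ) (Ps : Finset (Set (Fin d → ℝ))) (hPs : ∀ P ∈ Ps, IsMaximalPiece f P)
    (hmeet : ∀ P ∈ Ps, (P ∩ B).Nonempty) (hp : Ps.card = p)
    (fbar : (Fin d → ℝ) → ℝ) (hfbar : ∀ x, fbar x = min zmax (max zmin (f x))) :
    IsCPA fbar ∧
    (∀ x, zmin ≤ fbar x ∧ fbar x ≤ zmax) ∧
    (∃ g : Fin (k + 2) → (Fin d → ℝ) → ℝ,
      (∀ i, IsAffineFn (g i)) ∧ ∀ x, ∃ i, fbar x = g i x) ∧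
    ∃ Qs : Finset (Set (Fin d → ℝ)), (∀ Q ∈ Qs, IsMaximalPiece fbar Q) ∧ p ≤ Qs.card := by
  obtain rfl : fbar = fun x => min zmax (max zmin (f x)) := funext hfbar
  have hfc : Continuous f := hf.1
  obtain ⟨g, hg, hfg⟩ := hcomp
  have hcomp' : ∃ g : Fin (k + 2) → (Fin d → ℝ) → ℝ,
      (∀ i, IsAffineFn (g i)) ∧ ∀ x, ∃ i, min zmax (max zmin (f x)) = g i x := by
    refine ⟨Fin.cons (fun _ => zmin) (Fin.cons (fun _ => zmax) g : Fin (k + 1) → _), ?_, ?_⟩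
    · refine Fin.cases (IsAffineFn.const _) (Fin.cases (IsAffineFn.const _) hg)
    · intro x
      rcases min_choice zmax (max zmin (f x)) with h | h
      · exact ⟨Fin.succ 0, by simpa using h⟩
      · rcases max_choice zmin (f x) with h' | h'
        · exact ⟨0, by rw [h, h']; rfl⟩
        · obtain ⟨i, hi⟩ := hfg x
          exact ⟨i.succ.succ, by rw [h, h', hi]; rfl⟩
  refine ⟨?_, fun x => ⟨le_min hz.le (le_max_left _ _), min_le_left _ _⟩, hcomp', ?_⟩
  · obtain ⟨g', hg', hfg'⟩ := hcomp'
    exact isCPA_of_finite_components hg' (by fun_prop) hfg'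
  · classical
    have hex : ∀ P : Ps, ∃ Q, IsMaximalPiece (fun y => min zmax (max zmin (f y))) Q ∧
        Q.Nonempty ∧ Q ⊆ P := by
      rintro ⟨P, hP⟩
      obtain ⟨x, hxP, hxB⟩ := hmeet P hP
      obtain ⟨Q, hQ, hxQ, hQP⟩ :=
        (hPs P hP).exists_clamp_subset hfc hxP (hfB (mem_image_of_mem f hxB))
      exact ⟨Q, hQ, ⟨x, hxQ⟩, hQP⟩
    choose Q hQ hQne hQP using hex
    have hinj : Function.Injective Q := by
      intro P₁ P₂ h
      obtain ⟨x, hx⟩ := hQne P₁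
      have hx₁ : x ∈ (P₁ : Set (Fin d → ℝ)) := hQP P₁ hx
      have hx₂ : x ∈ (P₂ : Set (Fin d → ℝ)) := hQP P₂ (h ▸ hx)
      have h₁ := hPs P₁ P₁.2
      have h₂ := hPs P₂ P₂.2
      exact Subtype.ext (Subset.antisymm
        (h₂.subset_of_inter_nonempty h₁.1 h₁.2.1 h₁.2.2.1 ⟨x, hx₂, hx₁⟩)
        (h₁.subset_of_inter_nonempty h₂.1 h₂.2.1 h₂.2.2.1 ⟨x, hx₁, hx₂⟩))
    refine ⟨Finset.univ.image Q, fun R hR => ?_, ?_⟩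
    · obtain ⟨P, -, rfl⟩ := Finset.mem_image.1 hR
      exact hQ P
    · rw [Finset.card_image_of_injective _ hinj, Finset.card_univ, Fintype.card_coe, hp]
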